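/- arXiv:2410.17075 — 3 statements merged into one kernel-verified Lean document; each statement's English description precedes it below -/
import Mathlib

section
/- Let L > 0. For all vectors x, θ₁, θ₂ ∈ ℝ^d with ‖x‖₂ ≤ 1, ‖θ₁‖₂ ≤ L and ‖θ₂‖₂ ≤ L, and for each θ ∈ {θ₁, θ₂}, the bound α(x, θ₁, θ₂) ≥ ℓ̇(xᵀθ) / (1 + 2L) holds. -/
open Matrix

/-- The sigmoid (logistic) function `ℓ(x) = (1 + e^{−x})⁻¹`. -/
noncomputable def sigmoid (x : ℝ) : ℝ := (1 + Real.exp (-x))⁻¹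

/-- `α(x, θ₁, θ₂) := ∫₀¹ ℓ̇(v·xᵀθ₂ + (1−v)·xᵀθ₁) dv`. -/
noncomputable def alphaCoeff {d : ℕ} (x θ₁ θ₂ : Fin d → ℝ) : ℝ :=
  ∫ v in (0:ℝ)..1, deriv sigmoid (v * (x ⬝ᵥ θ₂) + (1 - v) * (x ⬝ᵥ θ₁))

theorem deriv_sigmoid_eq (x : ℝ) :
    deriv sigmoid x = (2 + Real.exp x + Real.exp (-x))⁻¹ := by
  have hpos : 0 < 1 + Real.exp (-x) := by positivity
  have h : HasDerivAt sigmoid (-(Real.exp (-x) * (-1)) / (1 + Real.exp (-x)) ^ 2) x :=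
    (((hasDerivAt_neg x).exp).const_add 1).inv hpos.ne'
  rw [h.deriv, Real.exp_neg]
  have := Real.exp_pos x
  field_simp
  ring

theorem continuous_deriv_sigmoid : Continuous (deriv sigmoid) := by
  rw [funext deriv_sigmoid_eq]
  exact Continuous.inv₀ (by fun_prop) fun x => by positivity

theorem deriv_sigmoid_pos (x : ℝ) : 0 < deriv sigmoid x := by
  rw [deriv_sigmoid_eq]
  positivity

/-- The derivative of the sigmoid decays at most exponentially. -/
theorem deriv_sigmoid_mul_exp_neg_abs_le (a b : ℝ) :
    deriv sigmoid a * Real.exp (-|b - a|) ≤ deriv sigmoid b := by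
  rw [deriv_sigmoid_eq, deriv_sigmoid_eq, Real.exp_neg |b - a|, ← mul_inv]
  apply inv_anti₀ (by positivity)
  have h₁ : Real.exp b ≤ Real.exp a * Real.exp |b - a| := by
    rw [← Real.exp_add]
    exact Real.exp_le_exp.2 (by linarith [le_abs_self (b - a)])
  have h₂ : Real.exp (-b) ≤ Real.exp (-a) * Real.exp |b - a| := by
    rw [← Real.exp_add]
    exact Real.exp_le_exp.2 (by linarith [neg_abs_le (b - a)])
  have h₃ : 1 ≤ Real.exp |b - a| := Real.one_le_exp (abs_nonneg _)
  linarith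

theorem inv_one_add_le_integral_exp_neg_mul {s : ℝ} (hs : 0 ≤ s) :
    (1 + s)⁻¹ ≤ ∫ v in (0:ℝ)..1, Real.exp (-(v * s)) := by
  rcases hs.eq_or_lt with rfl | hs
  · simp
  have hder (v : ℝ) : HasDerivAt (fun v => -Real.exp (-(v * s)) / s) (Real.exp (-(v * s))) v := by
    have h := ((((hasDerivAt_id v).mul_const s).neg).exp.neg).div_const s
    refine h.congr_deriv ?_
    simp only [Pi.neg_apply, id]
    field_simp
  rw [intervalIntegral.integral_eq_sub_of_hasDerivAt (fun v _ => hder v)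
    (Continuous.intervalIntegrable (by fun_prop) _ _)]
  have h : Real.exp (-s) ≤ (1 + s)⁻¹ := by
    rw [Real.exp_neg]
    exact inv_anti₀ (by positivity) (by linarith [Real.add_one_le_exp s])
  have h₂ : (1 + s)⁻¹ * s = 1 - (1 + s)⁻¹ := by
    field_simp
    ring
  simp only [one_mul, zero_mul, neg_zero, Real.exp_zero]
  rw [← sub_div, le_div_iff₀ hs]
  linarith

theorem deriv_sigmoid_div_le_integral (a b : ℝ) :
    deriv sigmoid a / (1 + |b - a|) ≤
      ∫ v in (0:ℝ)..1, deriv sigmoid (v * b + (1 - v) * a) := by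
  calc deriv sigmoid a / (1 + |b - a|)
      ≤ deriv sigmoid a * ∫ v in (0:ℝ)..1, Real.exp (-(v * |b - a|)) := by
        rw [div_eq_mul_inv]
        exact mul_le_mul_of_nonneg_left (inv_one_add_le_integral_exp_neg_mul (abs_nonneg _))
          (deriv_sigmoid_pos a).le
    _ = ∫ v in (0:ℝ)..1, deriv sigmoid a * Real.exp (-(v * |b - a|)) := by
        rw [intervalIntegral.integral_const_mul]
    _ ≤ _ := by
        refine intervalIntegral.integral_mono_on zero_le_one
          (Continuous.intervalIntegrable (by fun_prop) _ _)
          ((continuous_deriv_sigmoid.comp (by fun_prop)).intervalIntegrable _ _) fun v hv => ?_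
        have h := deriv_sigmoid_mul_exp_neg_abs_le a (v * b + (1 - v) * a)
        rwa [show v * b + (1 - v) * a - a = v * (b - a) by ring, abs_mul,
          abs_of_nonneg hv.1] at h

theorem alphaCoeff_comm {d : ℕ} (x θ₁ θ₂ : Fin d → ℝ) :
    alphaCoeff x θ₁ θ₂ = alphaCoeff x θ₂ θ₁ := by
  have h := intervalIntegral.integral_comp_sub_left (a := 0) (b := 1)
    (fun v => deriv sigmoid (v * (x ⬝ᵥ θ₁) + (1 - v) * (x ⬝ᵥ θ₂))) 1
  simp only [sub_self, sub_zero, sub_sub_cancel] at h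
  unfold alphaCoeff
  rw [← h]
  simp only [add_comm]

theorem abs_dotProduct_le_sqrt_mul_sqrt {d : ℕ} (x y : Fin d → ℝ) :
    |x ⬝ᵥ y| ≤ √(x ⬝ᵥ x) * √(y ⬝ᵥ y) := by
  have key (z : Fin d → ℝ) : z ⬝ᵥ y ≤ √(z ⬝ᵥ z) * √(y ⬝ᵥ y) := by
    simpa only [dotProduct, sq] using Real.sum_mul_le_sqrt_mul_sqrt Finset.univ z y
  refine abs_le'.2 ⟨key x, ?_⟩
  simpa using key (-x)

theorem deriv_sigmoid_div_le_alphaCoeff {d : ℕ} {L : ℝ} {x θ₁ θ₂ : Fin d → ℝ}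
    (hx : √(x ⬝ᵥ x) ≤ 1) (hθ₁ : √(θ₁ ⬝ᵥ θ₁) ≤ L) (hθ₂ : √(θ₂ ⬝ᵥ θ₂) ≤ L) :
    deriv sigmoid (x ⬝ᵥ θ₁) / (1 + 2 * L) ≤ alphaCoeff x θ₁ θ₂ := by
  have bound {θ : Fin d → ℝ} (hθ : √(θ ⬝ᵥ θ) ≤ L) : |x ⬝ᵥ θ| ≤ L :=
    (abs_dotProduct_le_sqrt_mul_sqrt x θ).trans
      ((mul_le_of_le_one_left (Real.sqrt_nonneg _) hx).trans hθ)
  have h : |x ⬝ᵥ θ₂ - x ⬝ᵥ θ₁| ≤ 2 * L :=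
    (abs_sub _ _).trans (by linarith [bound hθ₁, bound hθ₂])
  refine le_trans ?_ (deriv_sigmoid_div_le_integral (x ⬝ᵥ θ₁) (x ⬝ᵥ θ₂))
  exact div_le_div_of_nonneg_left (deriv_sigmoid_pos _).le (by positivity) (by linarith)

/-- If `‖x‖₂ ≤ 1`, `‖θ₁‖₂ ≤ L`, `‖θ₂‖₂ ≤ L` with `L > 0`, then for each
`θ ∈ {θ₁, θ₂}`, `α(x,θ₁,θ₂) ≥ ℓ̇(xᵀθ)/(1 + 2L)`. -/
theorem alphaCoeff_lower_bound_bounded {d : ℕ} (L : ℝ) (hL : 0 < L)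
    (x θ₁ θ₂ : Fin d → ℝ)
    (hx : Real.sqrt (x ⬝ᵥ x) ≤ 1)
    (hθ₁ : Real.sqrt (θ₁ ⬝ᵥ θ₁) ≤ L)
    (hθ₂ : Real.sqrt (θ₂ ⬝ᵥ θ₂) ≤ L) :
    ∀ θ ∈ ({θ₁, θ₂} : Set (Fin d → ℝ)),
      deriv sigmoid (x ⬝ᵥ θ) / (1 + 2 * L) ≤ alphaCoeff x θ₁ θ₂ := by
  rintro θ (rfl | rfl)
  · exact deriv_sigmoid_div_le_alphaCoeff hx hθ₁ hθ₂
  · rw [alphaCoeff_comm]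
    exact deriv_sigmoid_div_le_alphaCoeff hx hθ₂ hθ₁
end

section
/- For all vectors x, θ₁, θ₂ ∈ ℝ^d, α̃(x, θ₁, θ₂) ≥ ℓ̇(xᵀθ₁) / (2 + |xᵀ(θ₁ − θ₂)|); in particular, if L > 0, ‖x‖₂ ≤ 1, ‖θ₁‖₂ ≤ L and ‖θ₂‖₂ ≤ L, then α̃(x, θ₁, θ₂) ≥ ℓ̇(xᵀθ₁) / (2 + 2L). -/
open Matrix

/-- `α̃(x, θ₁, θ₂) := ∫₀¹ (1−v)·ℓ̇(v·xᵀθ₂ + (1−v)·xᵀθ₁) dv`. -/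
noncomputable def alphaTilde {d : ℕ} (x θ₁ θ₂ : Fin d → ℝ) : ℝ :=
  ∫ v in (0:ℝ)..1, (1 - v) * deriv sigmoid (v * (x ⬝ᵥ θ₂) + (1 - v) * (x ⬝ᵥ θ₁))

theorem deriv_sigmoid (x : ℝ) :
    deriv sigmoid x = (Real.exp x + 2 + Real.exp (-x))⁻¹ := by
  have h1 : HasDerivAt (fun y : ℝ => 1 + Real.exp (-y)) (Real.exp (-x) * (-1)) x :=
    ((hasDerivAt_neg x).exp).const_add 1
  have hpos : 0 < Real.exp (-x) := Real.exp_pos _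
  have h2 : HasDerivAt sigmoid _ x := h1.inv (by positivity)
  rw [h2.deriv]
  have hx : Real.exp x = (Real.exp (-x))⁻¹ := by rw [Real.exp_neg, inv_inv]
  rw [hx]
  field_simp
  ring

/-- Self-concordance of the sigmoid: moving by `s` shrinks `ℓ̇` by at most a factor `e^{-|s|}`. -/
theorem deriv_sigmoid_mul_exp_le (a s : ℝ) :
    deriv sigmoid a * Real.exp (-|s|) ≤ deriv sigmoid (a + s) := by
  rw [deriv_sigmoid, deriv_sigmoid, Real.exp_neg |s|, ← mul_inv]
  refine inv_anti₀ (by positivity) ?_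
  have h1 : Real.exp (a + s) ≤ Real.exp a * Real.exp |s| := by
    rw [← Real.exp_add]
    exact Real.exp_le_exp.2 (by linarith [le_abs_self s])
  have h2 : Real.exp (-(a + s)) ≤ Real.exp (-a) * Real.exp |s| := by
    rw [← Real.exp_add]
    exact Real.exp_le_exp.2 (by linarith [neg_abs_le s])
  have h3 : 1 ≤ Real.exp |s| := Real.one_le_exp (abs_nonneg s)
  linarith

theorem inv_two_add_le_integral_mul_exp {D : ℝ} (hD : 0 ≤ D) :
    1 / (2 + D) ≤ ∫ v in (0:ℝ)..1, (1 - v) * Real.exp (-(v * D)) := by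
  have hderiv : ∀ v : ℝ, HasDerivAt
      (fun v : ℝ => (v - v ^ 2) * Real.exp (-(D / 2)) - (1 - v) * Real.exp (-(v * D)))
      ((1 - 2 * v) * Real.exp (-(D / 2)) +
        (Real.exp (-(v * D)) + D * ((1 - v) * Real.exp (-(v * D))))) v := by
    intro v
    have hexp : HasDerivAt (fun v : ℝ => Real.exp (-(v * D))) _ v :=
      (((hasDerivAt_id v).mul_const D).neg).exp
    have hlin : HasDerivAt (fun v : ℝ => 1 - v) _ v := (hasDerivAt_id v).const_sub 1
    have hquad : HasDerivAt (fun v : ℝ => v - v ^ 2) _ v :=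
      (hasDerivAt_id v).sub (hasDerivAt_pow 2 v)
    refine ((hquad.mul_const (Real.exp (-(D / 2)))).sub (hlin.mul hexp)).congr_deriv ?_
    simp
    ring
  have hint := intervalIntegral.integral_eq_sub_of_hasDerivAt (a := 0) (b := 1)
    (fun v _ => hderiv v) (Continuous.intervalIntegrable (by fun_prop) _ _)
  have hmono : (∫ v in (0:ℝ)..1, ((1 - 2 * v) * Real.exp (-(D / 2)) +
        (Real.exp (-(v * D)) + D * ((1 - v) * Real.exp (-(v * D)))))) ≤
      ∫ v in (0:ℝ)..1, (2 + D) * ((1 - v) * Real.exp (-(v * D))) := by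
    refine intervalIntegral.integral_mono_on zero_le_one
      (Continuous.intervalIntegrable (by fun_prop) _ _)
      (Continuous.intervalIntegrable (by fun_prop) _ _) fun v _ => ?_
    have key : 0 ≤ (1 - 2 * v) * (Real.exp (-(v * D)) - Real.exp (-(D / 2))) := by
      rcases le_total v (1 / 2) with hv | hv
      · exact mul_nonneg (by linarith) (sub_nonneg.2 (Real.exp_le_exp.2 (by nlinarith)))
      · exact mul_nonneg_of_nonpos_of_nonpos (by linarith)
          (sub_nonpos.2 (Real.exp_le_exp.2 (by nlinarith)))
    linarith
  rw [hint, intervalIntegral.integral_const_mul] at hmono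
  rw [div_le_iff₀' (by positivity)]
  simpa using hmono

theorem deriv_sigmoid_div_le_alphaTilde {d : ℕ} (x θ₁ θ₂ : Fin d → ℝ) :
    deriv sigmoid (x ⬝ᵥ θ₁) / (2 + |x ⬝ᵥ (θ₁ - θ₂)|) ≤ alphaTilde x θ₁ θ₂ := by
  have hsig := continuous_deriv_sigmoid
  calc deriv sigmoid (x ⬝ᵥ θ₁) / (2 + |x ⬝ᵥ (θ₁ - θ₂)|)
      = deriv sigmoid (x ⬝ᵥ θ₁) * (1 / (2 + |x ⬝ᵥ (θ₁ - θ₂)|)) := by ring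
    _ ≤ deriv sigmoid (x ⬝ᵥ θ₁) *
          ∫ v in (0:ℝ)..1, (1 - v) * Real.exp (-(v * |x ⬝ᵥ (θ₁ - θ₂)|)) :=
        mul_le_mul_of_nonneg_left (inv_two_add_le_integral_mul_exp (abs_nonneg _))
          (deriv_sigmoid_pos _).le
    _ = ∫ v in (0:ℝ)..1, deriv sigmoid (x ⬝ᵥ θ₁) *
          ((1 - v) * Real.exp (-(v * |x ⬝ᵥ (θ₁ - θ₂)|))) :=
        (intervalIntegral.integral_const_mul _ _).symm
    _ ≤ alphaTilde x θ₁ θ₂ := by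
        refine intervalIntegral.integral_mono_on zero_le_one
          (Continuous.intervalIntegrable (by fun_prop) _ _)
          (Continuous.intervalIntegrable (by fun_prop) _ _) fun v hv => ?_
        have h := deriv_sigmoid_mul_exp_le (x ⬝ᵥ θ₁) (v * (x ⬝ᵥ θ₂ - x ⬝ᵥ θ₁))
        rw [abs_mul, abs_of_nonneg hv.1, abs_sub_comm, ← dotProduct_sub] at h
        have harg : v * (x ⬝ᵥ θ₂) + (1 - v) * (x ⬝ᵥ θ₁) =
            x ⬝ᵥ θ₁ + v * (x ⬝ᵥ θ₂ - x ⬝ᵥ θ₁) := by ring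
        rw [harg, mul_left_comm]
        exact mul_le_mul_of_nonneg_left h (sub_nonneg.2 hv.2)

theorem abs_dotProduct_le_sqrt_mul_sqrt_s7 {ι : Type*} [Fintype ι] (x y : ι → ℝ) :
    |x ⬝ᵥ y| ≤ Real.sqrt (x ⬝ᵥ x) * Real.sqrt (y ⬝ᵥ y) := by
  have hx : 0 ≤ x ⬝ᵥ x := Finset.sum_nonneg fun i _ => mul_self_nonneg (x i)
  rw [← Real.sqrt_mul hx]
  refine Real.abs_le_sqrt ?_
  simpa only [dotProduct, pow_two] using Finset.sum_mul_sq_le_sq_mul_sq Finset.univ x y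

/-- `α̃(x,θ₁,θ₂) ≥ ℓ̇(xᵀθ₁)/(2 + |xᵀ(θ₁−θ₂)|)`; in particular, if `L > 0`,
`‖x‖₂ ≤ 1`, `‖θ₁‖₂ ≤ L`, `‖θ₂‖₂ ≤ L`, then `α̃(x,θ₁,θ₂) ≥ ℓ̇(xᵀθ₁)/(2 + 2L)`. -/
theorem alphaTilde_lower_bound {d : ℕ} (x θ₁ θ₂ : Fin d → ℝ) :
    deriv sigmoid (x ⬝ᵥ θ₁) / (2 + |x ⬝ᵥ (θ₁ - θ₂)|) ≤ alphaTilde x θ₁ θ₂ ∧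
      ∀ L : ℝ, 0 < L → Real.sqrt (x ⬝ᵥ x) ≤ 1 →
        Real.sqrt (θ₁ ⬝ᵥ θ₁) ≤ L → Real.sqrt (θ₂ ⬝ᵥ θ₂) ≤ L →
        deriv sigmoid (x ⬝ᵥ θ₁) / (2 + 2 * L) ≤ alphaTilde x θ₁ θ₂ := by
  refine ⟨deriv_sigmoid_div_le_alphaTilde x θ₁ θ₂, fun L hL hx h₁ h₂ => ?_⟩
  refine le_trans ?_ (deriv_sigmoid_div_le_alphaTilde x θ₁ θ₂)
  have hbound : ∀ θ : Fin d → ℝ, Real.sqrt (θ ⬝ᵥ θ) ≤ L → |x ⬝ᵥ θ| ≤ L := fun θ hθ =>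
    calc |x ⬝ᵥ θ| ≤ Real.sqrt (x ⬝ᵥ x) * Real.sqrt (θ ⬝ᵥ θ) :=
          abs_dotProduct_le_sqrt_mul_sqrt_s7 x θ
      _ ≤ 1 * L := mul_le_mul hx hθ (Real.sqrt_nonneg _) zero_le_one
      _ = L := one_mul L
  have hdiff : |x ⬝ᵥ (θ₁ - θ₂)| ≤ 2 * L := by
    rw [dotProduct_sub]
    linarith [abs_sub (x ⬝ᵥ θ₁) (x ⬝ᵥ θ₂), hbound θ₁ h₁, hbound θ₂ h₂]
  exact div_le_div_of_nonneg_left (deriv_sigmoid_pos _).le (by positivity) (by linarith)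
end

section
/- Let d ≥ 1, and let m, K, T be positive integers. Let (τ_t)_{t≥1} be a sequence of subsets of {1, …, m} with |τ_t| ≤ K for all t ∈ {1, …, T}. Let (x_{t,i})_{t∈{1,…,T}, i∈τ_t} be vectors in ℝ^d with ‖x_{t,i}‖₂ ≤ 1 for all t and all i ∈ τ_t. Let (λ_t)_{t≥1} be a nondecreasing sequence of positive reals with λ₁ ≥ K, and for t ≥ 1 define V_t := Σ_{s=1}^{t−1} Σ_{i∈τ_s} x_{s,i}x_{s,i}ᵀ + λ_t·I_d. Then for every t ∈ {1, …, T}, Σ_{s=1}^{t} Σ_{i∈τ_s} ‖x_{s,i}‖²_{V_s⁻¹} ≤ 2·d·log(λ_{t+1} + t). -/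
open Matrix

/-- `V_t := Σ_{s=1}^{t−1} Σ_{i∈τ_s} x_{s,i}x_{s,i}ᵀ + λ_t·I`. -/
noncomputable def Vmat {d m : ℕ} (τ : ℕ → Finset (Fin m))
    (x : ℕ → Fin m → Fin d → ℝ) (lam : ℕ → ℝ) (t : ℕ) :
    Matrix (Fin d) (Fin d) ℝ :=
  (∑ s ∈ Finset.Ico 1 t, ∑ i ∈ τ s, Matrix.vecMulVec (x s i) (x s i)) + lam t • 1

section PotentialLemmas

lemma one_add_sum_le_prod_one_add {ι : Type*} (s : Finset ι) {f : ι → ℝ} (hf : ∀ i, 0 ≤ f i) :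
    1 + ∑ i ∈ s, f i ≤ ∏ i ∈ s, (1 + f i) := by
  classical
  induction s using Finset.induction_on with
  | empty => simp
  | insert a s ha ih =>
    rw [Finset.sum_insert ha, Finset.prod_insert ha]
    nlinarith [hf a, mul_nonneg (hf a) (Finset.sum_nonneg fun i (_ : i ∈ s) => hf i)]

variable {n : Type*} [Fintype n]

lemma posSemidef_vecMulVec_self (v : n → ℝ) : (vecMulVec v v).PosSemidef := by
  simpa using posSemidef_vecMulVec_self_star v

lemma trace_mul_sum_vecMulVec {ι : Type*} (A : Matrix n n ℝ) (s : Finset ι) (v : ι → n → ℝ) :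
    (A * ∑ i ∈ s, vecMulVec (v i) (v i)).trace = ∑ i ∈ s, v i ⬝ᵥ A *ᵥ v i := by
  simp [Finset.mul_sum, trace_sum, mul_vecMulVec, trace_vecMulVec, dotProduct_comm]

lemma posSemidef_sum_vecMulVec_self {ι : Type*} (s : Finset ι) (v : ι → n → ℝ) :
    (∑ i ∈ s, vecMulVec (v i) (v i)).PosSemidef :=
  posSemidef_sum _ fun i _ => posSemidef_vecMulVec_self (v i)

variable [DecidableEq n]

lemma Matrix.PosSemidef.one_add_trace_le_det_one_add {C : Matrix n n ℝ} (hC : C.PosSemidef) :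
    1 + C.trace ≤ (1 + C).det := by
  have hdet : (1 + C).det = ∏ i, (1 + hC.1.eigenvalues i) := by
    have h := congrArg (Polynomial.eval (-1)) hC.1.charpoly_eq
    rw [Matrix.eval_charpoly, Polynomial.eval_prod] at h
    have h1 : scalar n (-1 : ℝ) - C = -(1 + C) := by
      rw [map_neg, map_one]; abel
    have h2 : ∀ i, Polynomial.eval (-1 : ℝ)
        (Polynomial.X - Polynomial.C ((hC.1.eigenvalues i : ℝ))) =
        -1 * (1 + hC.1.eigenvalues i) := fun i => by simp; ring
    rw [h1, det_neg] at h
    have h3 := (Finset.prod_congr rfl fun i _ => h2 i : ∏ i, _ = _)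
    rw [Finset.prod_mul_distrib, Finset.prod_const, Finset.card_univ] at h3
    exact mul_left_cancel₀ (pow_ne_zero _ (by norm_num)) (h.trans h3)
  have htr : C.trace = ∑ i, hC.1.eigenvalues i := by
    simpa using hC.1.trace_eq_sum_eigenvalues
  rw [hdet, htr]
  exact one_add_sum_le_prod_one_add _ hC.eigenvalues_nonneg

open scoped MatrixOrder Matrix.Norms.L2Operator in
lemma Matrix.PosDef.exists_isUnit_eq_conjTranspose_mul_self {A : Matrix n n ℝ} (hA : A.PosDef) :
    ∃ S : Matrix n n ℝ, IsUnit S ∧ A = Sᴴ * S := by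
  obtain ⟨S, hS, h⟩ := CStarAlgebra.isStrictlyPositive_iff_eq_star_mul_self.mp
    hA.isStrictlyPositive
  exact ⟨S, hS, h⟩

lemma Matrix.PosDef.det_mul_one_add_trace_le_det_add {A B : Matrix n n ℝ}
    (hA : A.PosDef) (hB : B.PosSemidef) :
    A.det * (1 + (A⁻¹ * B).trace) ≤ (A + B).det := by
  obtain ⟨S, hS, rfl⟩ := hA.exists_isUnit_eq_conjTranspose_mul_self
  have hSd : IsUnit S.det := (isUnit_iff_isUnit_det S).mp hS
  have hSd' : IsUnit Sᴴ.det := by simpa using hSd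
  have hC := hB.conjTranspose_mul_mul_same S⁻¹
  have hadd : Sᴴ * S + B = Sᴴ * (1 + S⁻¹ᴴ * B * S⁻¹) * S := by
    rw [mul_add, add_mul, mul_one, conjTranspose_nonsing_inv]
    congr 1
    rw [← mul_assoc, ← mul_assoc, mul_nonsing_inv _ hSd', one_mul, mul_assoc,
      nonsing_inv_mul _ hSd, mul_one]
  have htr : ((Sᴴ * S)⁻¹ * B).trace = (S⁻¹ᴴ * B * S⁻¹).trace := by
    rw [Matrix.mul_inv_rev, conjTranspose_nonsing_inv, mul_assoc, trace_mul_comm]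
  have hle := mul_le_mul_of_nonneg_left hC.one_add_trace_le_det_one_add hA.posSemidef.det_nonneg
  rw [htr, hadd]
  refine hle.trans_eq ?_
  simp only [det_mul]
  ring

lemma Matrix.PosDef.det_le_det_add {A B : Matrix n n ℝ}
    (hA : A.PosDef) (hB : B.PosSemidef) : A.det ≤ (A + B).det := by
  obtain ⟨S, hS, rfl⟩ := hA.exists_isUnit_eq_conjTranspose_mul_self
  have hC := hB.conjTranspose_mul_mul_same S⁻¹
  have htr : ((Sᴴ * S)⁻¹ * B).trace = (S⁻¹ᴴ * B * S⁻¹).trace := by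
    rw [Matrix.mul_inv_rev, conjTranspose_nonsing_inv, mul_assoc, trace_mul_comm]
  refine le_trans ?_ (hA.det_mul_one_add_trace_le_det_add hB)
  rw [htr]
  exact le_mul_of_one_le_right hA.posSemidef.det_nonneg (by linarith [hC.trace_nonneg])

lemma posSemidef_one_sub_vecMulVec_self {v : n → ℝ} (hv : v ⬝ᵥ v ≤ 1) :
    (1 - vecMulVec v v).PosSemidef := by
  refine PosSemidef.of_dotProduct_mulVec_nonneg
    (isHermitian_one.sub (posSemidef_vecMulVec_self v).1) fun y => ?_
  have hcs : (v ⬝ᵥ y) ^ 2 ≤ (v ⬝ᵥ v) * (y ⬝ᵥ y) := by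
    simpa [dotProduct, sq] using Finset.sum_mul_sq_le_sq_mul_sq Finset.univ v y
  have hy : 0 ≤ y ⬝ᵥ y := dotProduct_self_star_nonneg y
  have : star y ⬝ᵥ (1 - vecMulVec v v) *ᵥ y = y ⬝ᵥ y - (v ⬝ᵥ y) ^ 2 := by
    simp [sub_mulVec, vecMulVec_mulVec, dotProduct_sub, dotProduct_comm y v, sq]
  rw [this]
  nlinarith

/-- If `A ≥ c`, then `‖v‖²_{A⁻¹} ≤ ‖v‖² / c`. -/
lemma dotProduct_inv_mulVec_le {B : Matrix n n ℝ} (hB : B.PosSemidef) {c : ℝ} (hc : 0 < c)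
    (v : n → ℝ) : v ⬝ᵥ (B + c • 1)⁻¹ *ᵥ v ≤ (v ⬝ᵥ v) / c := by
  have hA : (B + c • 1).PosDef := PosDef.posSemidef_add hB (PosDef.one.smul hc)
  set y := (B + c • 1)⁻¹ *ᵥ v with hy
  have hv : (B + c • 1) *ᵥ y = v := by
    rw [hy, mulVec_mulVec, mul_nonsing_inv _ ((isUnit_iff_isUnit_det _).mp hA.isUnit), one_mulVec]
  have hB' : 0 ≤ y ⬝ᵥ B *ᵥ y := hB.dotProduct_mulVec_nonneg y
  have hvy : v ⬝ᵥ y = y ⬝ᵥ B *ᵥ y + c * (y ⬝ᵥ y) := by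
    conv_lhs => rw [← hv]
    rw [dotProduct_comm]
    simp [add_mulVec, smul_mulVec]
  have hcs : (v ⬝ᵥ y) ^ 2 ≤ (v ⬝ᵥ v) * (y ⬝ᵥ y) := by
    simpa [dotProduct, sq] using Finset.sum_mul_sq_le_sq_mul_sq Finset.univ v y
  have hvv : 0 ≤ v ⬝ᵥ v := dotProduct_self_star_nonneg v
  have hyy : 0 ≤ y ⬝ᵥ y := dotProduct_self_star_nonneg y
  rw [le_div_iff₀ hc]
  by_contra! h
  have h0 : 0 < v ⬝ᵥ y := by
    by_contra! h'
    nlinarith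
  nlinarith

lemma le_two_mul_log_one_add {a : ℝ} (h0 : 0 ≤ a) (h1 : a ≤ 1) : a ≤ 2 * Real.log (1 + a) := by
  have h := Real.one_sub_inv_le_log_of_pos (show 0 < 1 + a by linarith)
  have : a / 2 ≤ 1 - (1 + a)⁻¹ := by
    rw [show 1 - (1 + a)⁻¹ = a / (1 + a) by field_simp; ring]
    gcongr
    linarith
  linarith

lemma posSemidef_smul_one_sub_sum_vecMulVec_self {ι : Type*} {s : Finset ι} {v : ι → n → ℝ}
    (hv : ∀ i ∈ s, v i ⬝ᵥ v i ≤ 1) {K : ℝ} (hs : (s.card : ℝ) ≤ K) :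
    (K • 1 - ∑ i ∈ s, vecMulVec (v i) (v i)).PosSemidef := by
  have h1 : (∑ i ∈ s, (1 - vecMulVec (v i) (v i))).PosSemidef :=
    posSemidef_sum _ fun i hi => posSemidef_one_sub_vecMulVec_self (hv i hi)
  have h2 := h1.add ((PosSemidef.one (n := n) (R := ℝ)).smul (sub_nonneg.mpr hs))
  convert h2 using 1
  rw [Finset.sum_sub_distrib, Finset.sum_const, sub_smul, Nat.cast_smul_eq_nsmul]
  abel

/-- Adding a small positive semidefinite Gram matrix to `B + c` increases the log-determinant by
at least half of the corresponding potential. -/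
lemma sum_dotProduct_inv_mulVec_le_two_mul_log_det {ι : Type*} {B R : Matrix n n ℝ}
    (hB : B.PosSemidef) (hR : R.PosSemidef) {c : ℝ} (hc : 0 < c) {s : Finset ι}
    {v : ι → n → ℝ} (hv : ∀ i ∈ s, v i ⬝ᵥ v i ≤ 1) (hs : (s.card : ℝ) ≤ c) :
    ∑ i ∈ s, v i ⬝ᵥ (B + c • 1)⁻¹ *ᵥ v i ≤
      2 * (Real.log (B + c • 1 + ∑ i ∈ s, vecMulVec (v i) (v i) + R).det -
        Real.log (B + c • 1).det) := by
  have hA : (B + c • 1).PosDef := PosDef.posSemidef_add hB (PosDef.one.smul hc)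
  have hX := posSemidef_sum_vecMulVec_self s v
  set a := ∑ i ∈ s, v i ⬝ᵥ (B + c • 1)⁻¹ *ᵥ v i with ha
  have h0 : 0 ≤ a := Finset.sum_nonneg fun i _ =>
    hA.inv.posSemidef.dotProduct_mulVec_nonneg (v i)
  have h1 : a ≤ 1 := by
    calc a ≤ ∑ _i ∈ s, 1 / c := Finset.sum_le_sum fun i hi =>
          (dotProduct_inv_mulVec_le hB hc (v i)).trans (by gcongr; exact hv i hi)
      _ = s.card / c := by simp [div_eq_mul_inv]
      _ ≤ 1 := (div_le_one hc).mpr hs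
  have hdet := (hA.det_mul_one_add_trace_le_det_add hX).trans
    ((hA.add_posSemidef hX).det_le_det_add hR)
  rw [trace_mul_sum_vecMulVec, ← ha] at hdet
  have hpos : 0 < 1 + a := by linarith
  have hlog := Real.log_le_log (mul_pos hA.det_pos hpos) hdet
  rw [Real.log_mul hA.det_pos.ne' hpos.ne'] at hlog
  linarith [le_two_mul_log_one_add h0 h1]

end PotentialLemmas

/-- Elliptical potential lemma with multiple arms and time-varying
regularization: for every `t ∈ {1, …, T}`,
`Σ_{s=1}^{t} Σ_{i∈τ_s} ‖x_{s,i}‖²_{V_s⁻¹} ≤ 2·d·log(λ_{t+1} + t)`. -/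
theorem elliptical_potential {d m : ℕ} (hd : 1 ≤ d) (hm : 0 < m)
    (K T : ℕ) (hK : 0 < K) (hT : 0 < T)
    (τ : ℕ → Finset (Fin m)) (hτ : ∀ t ∈ Finset.Icc 1 T, (τ t).card ≤ K)
    (x : ℕ → Fin m → Fin d → ℝ)
    (hx : ∀ t ∈ Finset.Icc 1 T, ∀ i ∈ τ t, Real.sqrt (x t i ⬝ᵥ x t i) ≤ 1)
    (lam : ℕ → ℝ) (hpos : ∀ t, 1 ≤ t → 0 < lam t)
    (hmono : ∀ s t, 1 ≤ s → s ≤ t → lam s ≤ lam t)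
    (hlam1 : (K : ℝ) ≤ lam 1) :
    ∀ t ∈ Finset.Icc 1 T,
      ∑ s ∈ Finset.Icc 1 t, ∑ i ∈ τ s,
          x s i ⬝ᵥ ((Vmat τ x lam s)⁻¹ *ᵥ x s i) ≤
        2 * d * Real.log (lam (t + 1) + t) := by
  have hx' : ∀ t ∈ Finset.Icc 1 T, ∀ i ∈ τ t, x t i ⬝ᵥ x t i ≤ 1 := fun t ht i hi =>
    by
    simpa using (Real.sqrt_le_iff.mp (hx t ht i hi)).2
  have hgram : ∀ t, (∑ s ∈ Finset.Ico 1 t, ∑ i ∈ τ s, vecMulVec (x s i) (x s i)).PosSemidef :=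
    fun t => posSemidef_sum _ fun s _ => posSemidef_sum_vecMulVec_self (τ s) (x s)
  have hK1 : (1 : ℝ) ≤ K := by exact_mod_cast hK
  have hl1 : 0 < lam 1 := hpos 1 le_rfl
  have hpot : ∀ t, 1 ≤ t → t ≤ T + 1 →
      ∑ s ∈ Finset.Ico 1 t, ∑ i ∈ τ s, x s i ⬝ᵥ ((Vmat τ x lam s)⁻¹ *ᵥ x s i) ≤
        2 * (Real.log (Vmat τ x lam t).det - d * Real.log (lam 1)) := by
    intro t ht
    induction t, ht using Nat.le_induction with
    | base => intro _; simp [Vmat]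
    | succ t ht ih =>
      intro htT
      have htm : t ∈ Finset.Icc 1 T := Finset.mem_Icc.mpr ⟨ht, by omega⟩
      have hstep : Vmat τ x lam (t + 1) = Vmat τ x lam t +
          ∑ i ∈ τ t, vecMulVec (x t i) (x t i) + (lam (t + 1) - lam t) • 1 := by
        simp only [Vmat, Finset.sum_Ico_succ_top ht, sub_smul]
        abel
      have hcard : ((τ t).card : ℝ) ≤ lam t :=
        (Nat.cast_le.mpr (hτ t htm)).trans (hlam1.trans (hmono 1 t le_rfl ht))
      have hinc := sum_dotProduct_inv_mulVec_le_two_mul_log_det (hgram t)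
        ((PosSemidef.one (n := Fin d) (R := ℝ)).smul
          (sub_nonneg.mpr (hmono t (t + 1) ht t.le_succ)))
        (hpos t ht) (hx' t htm) hcard
      change ∑ i ∈ τ t, x t i ⬝ᵥ ((Vmat τ x lam t)⁻¹ *ᵥ x t i) ≤
        2 * (Real.log (Vmat τ x lam t + _ + _).det - Real.log (Vmat τ x lam t).det) at hinc
      rw [← hstep] at hinc
      rw [Finset.sum_Ico_succ_top ht]
      linarith [ih (by omega)]
  intro t ht
  obtain ⟨ht1, htT⟩ := Finset.mem_Icc.mp ht
  have hl : 0 < lam (t + 1) := hpos (t + 1) (by omega)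
  have hV : (Vmat τ x lam (t + 1)).PosDef :=
    PosDef.posSemidef_add (hgram (t + 1)) (PosDef.one.smul hl)
  have hdet : (Vmat τ x lam (t + 1)).det ≤ (lam (t + 1) + t * K) ^ d := by
    have hR : (∑ s ∈ Finset.Ico 1 (t + 1),
        ((K : ℝ) • 1 - ∑ i ∈ τ s, vecMulVec (x s i) (x s i))).PosSemidef := by
      refine posSemidef_sum _ fun s hs => ?_
      have hsm : s ∈ Finset.Icc 1 T := by
        simp only [Finset.mem_Ico, Finset.mem_Icc] at hs ⊢
        omega
      exact posSemidef_smul_one_sub_sum_vecMulVec_self (hx' s hsm) (Nat.cast_le.mpr (hτ s hsm))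
    refine (hV.det_le_det_add hR).trans_eq ?_
    have hsum : Vmat τ x lam (t + 1) + ∑ s ∈ Finset.Ico 1 (t + 1),
        ((K : ℝ) • 1 - ∑ i ∈ τ s, vecMulVec (x s i) (x s i)) = (lam (t + 1) + t * K) • 1 := by
      rw [Finset.sum_sub_distrib, Finset.sum_const, Nat.card_Ico, Nat.add_sub_cancel, Vmat,
        add_smul, mul_smul, Nat.cast_smul_eq_nsmul ℝ t]
      abel
    rw [hsum]
    simp
  have hlogdet := Real.log_le_log hV.det_pos hdet
  rw [Real.log_pow] at hlogdet
  have hscale : lam (t + 1) + t * K ≤ lam 1 * (lam (t + 1) + t) := by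
    have : (t : ℝ) * K ≤ t * lam 1 := by gcongr
    nlinarith
  have hlog := Real.log_le_log (by positivity) hscale
  rw [Real.log_mul hl1.ne' (by positivity)] at hlog
  have hmul := mul_le_mul_of_nonneg_left hlog (Nat.cast_nonneg (α := ℝ) d)
  have hfin := hpot (t + 1) (by omega) (by omega)
  rw [show Finset.Icc 1 t = Finset.Ico 1 (t + 1) by ext; simp]
  linarith
end
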